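/- For every ν ∈ ℝ and every real z with 0 < z < 2/(1-q²), one has I_ν^{(1)}((1-q²)z;q²) = e_{q²}((1-q²)² z²/4) · I_ν^{(2)}((1-q²)z;q²); equivalently, I_ν^{(2)}((1-q²)z;q²) = ((1-q²)² z²/4; q²)_∞ · I_ν^{(1)}((1-q²)z;q²). -/

import Mathlib

open Real Filter

noncomputable section

/-- Finite q-Pochhammer symbol `(a;q)_n = ∏_{j=0}^{n-1} (1 - a q^j)`. -/
def qPoch (a q : ℝ) (n : ℕ) : ℝ := ∏ j ∈ Finset.range n, (1 - a * q ^ j)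

/-- Infinite q-Pochhammer symbol `(a;q)_∞ = ∏_{j=0}^{∞} (1 - a q^j)`. -/
def qPochInf (a q : ℝ) : ℝ := ∏' j : ℕ, (1 - a * q ^ j)

/-- The q²-Gamma function `Γ_{q²}(x) = (q²;q²)_∞ (1-q²)^{1-x} / (q^{2x};q²)_∞`. -/
def qGamma (q x : ℝ) : ℝ :=
  qPochInf (q ^ 2) (q ^ 2) * (1 - q ^ 2) ^ (1 - x) / qPochInf (q ^ (2 * x)) (q ^ 2)

/-- The reciprocal `1/Γ_{q²}(x)`, interpreted as `(q^{2x};q²)_∞ (1-q²)^{x-1} / (q²;q²)_∞`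
(vanishing at nonpositive integers `x`). -/
def qGammaInv (q x : ℝ) : ℝ :=
  qPochInf (q ^ (2 * x)) (q ^ 2) * (1 - q ^ 2) ^ (x - 1) / qPochInf (q ^ 2) (q ^ 2)

/-- `δ(1) = 2`, `δ(2) = 0`, `δ(3) = 1`. -/
def delta : ℕ → ℝ
  | 1 => 2
  | 2 => 0
  | 3 => 1
  | _ => 0

/-- The modified q-Bessel function of kind `j`: `Iq q j ν z = I_ν^{(j)}((1-q²)z; q²)`.
The extra power of `q` in the `k`-th term is `q^{(2-δ(j)) k (ν+k)}`, i.e. `1` for `j = 1`,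
`q^{2k(ν+k)}` for `j = 2`, and `q^{k(ν+k)}` for `j = 3`. -/
def Iq (q : ℝ) (j : ℕ) (ν z : ℝ) : ℝ :=
  ∑' k : ℕ,
    q ^ ((2 - delta j) * k * (ν + k)) * (1 - q ^ 2) ^ k * (z / 2) ^ (ν + 2 * k)
      / qPoch (q ^ 2) (q ^ 2) k * qGammaInv q (ν + k + 1)



lemma summable_ap (a p : ℝ) (hp0 : 0 < p) (hp1 : p < 1) : Summable (fun j : ℕ => ‖-(a * p ^ j)‖) := by
  have := ((summable_geometric_of_lt_one hp0.le hp1).mul_left |a|)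
  refine this.congr fun j => ?_
  rw [norm_neg, norm_mul, Real.norm_eq_abs, Real.norm_eq_abs, abs_of_pos (pow_pos hp0 j)]

lemma mult_ap (a p : ℝ) (hp0 : 0 < p) (hp1 : p < 1) : Multipliable (fun j : ℕ => 1 - a * p ^ j) := by
  have := multipliable_one_add_of_summable (summable_ap a p hp0 hp1)
  simpa [sub_eq_add_neg] using this

lemma qPochInf_step (a p : ℝ) (hp0 : 0 < p) (hp1 : p < 1) :
    qPochInf a p = (1 - a) * qPochInf (p * a) p := by
  have h := mult_ap (p * a) p hp0 hp1
  have h2 : ∀ j : ℕ, 1 - p * a * p ^ j = 1 - a * p ^ (j + 1) := fun j => by ring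
  have h3 : Multipliable (fun j : ℕ => 1 - a * p ^ (j + 1)) := h.congr h2
  have h4 : qPochInf (p * a) p = ∏' j : ℕ, (1 - a * p ^ (j + 1)) := tprod_congr h2
  have h5 := tprod_eq_zero_mul' (f := fun j : ℕ => 1 - a * p ^ j) h3
  rw [h4]
  simp only [pow_zero, mul_one] at h5
  unfold qPochInf
  exact h5

lemma qPochInf_bound (a p : ℝ) (ha : 0 ≤ a) (hp0 : 0 < p) (hp1 : p < 1) :
    |qPochInf a p - 1| ≤ Real.exp (a / (1 - p)) - 1 := by
  have h := (mult_ap a p hp0 hp1).hasProd.tendsto_prod_nat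
  have h2 : Tendsto (fun n => |∏ j ∈ Finset.range n, (1 - a * p ^ j) - 1|) atTop
      (nhds |qPochInf a p - 1|) := (h.sub_const 1).abs
  refine le_of_tendsto' h2 fun n => ?_
  have h3 := (Finset.range n).norm_prod_one_add_sub_one_le (fun j : ℕ => -(a * p ^ j))
  simp only [← sub_eq_add_neg, Real.norm_eq_abs] at h3
  refine h3.trans ?_
  gcongr
  have hs : HasSum (fun j : ℕ => a * p ^ j) (a * (1 - p)⁻¹) :=
    (hasSum_geometric_of_lt_one hp0.le hp1).mul_left a
  have : ∀ j : ℕ, |-(a * p ^ j)| = a * p ^ j := fun j => by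
    rw [abs_neg, abs_of_nonneg]; positivity
  simp only [this]
  rw [div_eq_mul_inv]
  exact sum_le_hasSum _ (fun i _ => by positivity) hs

lemma qPoch_pos (p : ℝ) (hp0 : 0 < p) (hp1 : p < 1) (k : ℕ) : 0 < qPoch p p k := by
  unfold qPoch
  refine Finset.prod_pos fun j _ => ?_
  rw [← pow_succ']
  have := pow_lt_one₀ hp0.le hp1 (Nat.succ_ne_zero j)
  simp only [Nat.succ_eq_add_one] at this
  linarith

lemma qPoch_succ (p : ℝ) (k : ℕ) : qPoch p p (k+1) = qPoch p p k * (1 - p ^ (k+1)) := by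
  unfold qPoch
  rw [Finset.prod_range_succ, ← pow_succ']

lemma summable_u (p w : ℝ) (hp0 : 0 < p) (hp1 : p < 1) (hw0 : 0 < w) (hw1 : w < 1) :
    Summable (fun k : ℕ => w ^ k / qPoch p p k) := by
  have hpos := qPoch_pos p hp0 hp1
  have ht : Tendsto (fun k : ℕ => p ^ (k+1)) atTop (nhds 0) :=
    (tendsto_add_atTop_iff_nat 1).2 (tendsto_pow_atTop_nhds_zero_of_lt_one hp0.le hp1)
  refine summable_of_ratio_test_tendsto_lt_one hw1 (Eventually.of_forall fun k => ?_) ?_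
  · have := hpos k; positivity
  · have h1 : Tendsto (fun k : ℕ => w / (1 - p ^ (k+1))) atTop (nhds (w / (1 - 0))) :=
      tendsto_const_nhds.div (tendsto_const_nhds.sub ht) (by norm_num)
    simp only [sub_zero, div_one] at h1
    refine h1.congr fun k => ?_
    have h2 := hpos k
    have h3 := hpos (k+1)
    rw [Real.norm_of_nonneg (by positivity), Real.norm_of_nonneg (by positivity)]
    rw [qPoch_succ] at h3 ⊢
    have h4 : 0 < 1 - p ^ (k+1) := (pos_iff_pos_of_mul_pos h3).1 h2
    field_simp
    ring

lemma summable_v (p w c : ℝ) (hp0 : 0 < p) (hp1 : p < 1) (hw0 : 0 < w) (hc : 0 < c) :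
    Summable (fun k : ℕ => c ^ k * p ^ (k ^ 2) * w ^ k / qPoch p p k) := by
  have hpos := qPoch_pos p hp0 hp1
  have ht0 := (tendsto_pow_atTop_nhds_zero_of_lt_one hp0.le hp1)
  have ht : Tendsto (fun k : ℕ => p ^ (k+1)) atTop (nhds 0) :=
    (tendsto_add_atTop_iff_nat 1).2 ht0
  refine summable_of_ratio_test_tendsto_lt_one zero_lt_one (Eventually.of_forall fun k => ?_) ?_
  · have := hpos k; positivity
  · have h1 : Tendsto (fun k : ℕ => c * w * (p ^ k * p ^ (k+1)) / (1 - p ^ (k+1))) atTop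
        (nhds (c * w * (0 * 0) / (1 - 0))) :=
      ((ht0.mul ht).const_mul _).div (tendsto_const_nhds.sub ht) (by norm_num)
    simp only [mul_zero, zero_div] at h1
    refine h1.congr fun k => ?_
    have h2 := hpos k
    have h3 := hpos (k+1)
    rw [Real.norm_of_nonneg (by positivity), Real.norm_of_nonneg (by positivity)]
    rw [qPoch_succ] at h3 ⊢
    have h4 : 0 < 1 - p ^ (k+1) := (pos_iff_pos_of_mul_pos h3).1 h2
    have h5 : p ^ ((k+1)^2) = p ^ (k^2) * (p ^ k * p ^ (k+1)) := by ring
    rw [h5]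
    field_simp
    ring

/-- scaled power series are close to their constant term. -/
lemma series_close (b u : ℕ → ℝ) (B p : ℝ) (hp0 : 0 < p) (hp1 : p < 1) (hB : 0 ≤ B)
    (hu0 : ∀ k, 0 ≤ u k)
    (hu : Summable u) (hb : ∀ k, |b k| ≤ u k * B) (N : ℕ) :
    |∑' k, b k * (p ^ N) ^ k - b 0| ≤ p ^ N * (B * ∑' k, u k) := by
  have hN0 : 0 < p ^ N := pow_pos hp0 N
  have hN1 : p ^ N ≤ 1 := pow_le_one₀ hp0.le hp1.le
  have hs : Summable (fun k => b k * (p ^ N) ^ k) := by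
    refine Summable.of_norm_bounded (hu.mul_right B) fun k => ?_
    rw [norm_mul, Real.norm_eq_abs, Real.norm_eq_abs, abs_of_pos (pow_pos hN0 k)]
    exact (mul_le_of_le_one_right (abs_nonneg _) (pow_le_one₀ hN0.le hN1)).trans (hb k)
  rw [hs.tsum_eq_zero_add]
  simp only [pow_zero, mul_one, add_sub_cancel_left]
  have hs1 := (summable_nat_add_iff 1).2 hu
  have h1 : ‖∑' k, b (k+1) * (p ^ N) ^ (k+1)‖ ≤ ∑' k, u (k+1) * (p ^ N * B) := by
    refine tsum_of_norm_bounded (hs1.mul_right _).hasSum fun k => ?_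
    rw [norm_mul, Real.norm_eq_abs, Real.norm_eq_abs, abs_of_pos (pow_pos hN0 _), pow_succ]
    have h2 := hb (k+1)
    have h3 : (p ^ N) ^ k ≤ 1 := pow_le_one₀ hN0.le hN1
    have h4 : (p ^ N) ^ k * p ^ N ≤ p ^ N := mul_le_of_le_one_left hN0.le h3
    calc _ ≤ (u (k+1) * B) * p ^ N := mul_le_mul h2 h4 (by positivity) (mul_nonneg (hu0 _) hB)
      _ = _ := by ring
  rw [Real.norm_eq_abs] at h1
  refine h1.trans ?_
  rw [tsum_mul_right]
  have h5 : ∑' k, u (k+1) ≤ ∑' k, u k := by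
    rw [hu.tsum_eq_zero_add]; linarith [hu0 0]
  calc _ ≤ (∑' k, u k) * (p ^ N * B) := by gcongr
    _ = _ := by ring

lemma core (p c w : ℝ) (A : ℕ → ℝ) (B : ℝ) (hp0 : 0 < p) (hp1 : p < 1) (hw0 : 0 < w) (hw1 : w < 1)
    (hc : 0 < c) (hB : 0 ≤ B) (hA : ∀ k, |A k| ≤ B)
    (hrec : ∀ k, A k = (1 - c * p ^ (k+1)) * A (k+1)) :
    ∑' k : ℕ, c ^ k * p ^ (k ^ 2) * w ^ k / qPoch p p k * A k
      = qPochInf w p * ∑' k : ℕ, w ^ k / qPoch p p k * A k := by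
  have hpos := qPoch_pos p hp0 hp1
  set F : ℕ → ℝ → ℝ := fun m x => ∑' k : ℕ, x ^ k / qPoch p p k * A (k + m) with hF
  set G : ℕ → ℝ → ℝ :=
    fun m x => ∑' k : ℕ, (c * p ^ m) ^ k * p ^ (k ^ 2) * x ^ k / qPoch p p k * A (k + m) with hG
  have sF : ∀ m x, 0 < x → x < 1 → Summable (fun k : ℕ => x ^ k / qPoch p p k * A (k + m)) := by
    intro m x hx0 hx1
    refine Summable.of_norm_bounded ((summable_u p x hp0 hp1 hx0 hx1).mul_right B) fun k => ?_
    have := hpos k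
    rw [norm_mul, Real.norm_of_nonneg (by positivity)]
    exact mul_le_mul_of_nonneg_left (hA _) (by positivity)
  have sG : ∀ m x, 0 < x → Summable (fun k : ℕ =>
      (c * p ^ m) ^ k * p ^ (k ^ 2) * x ^ k / qPoch p p k * A (k + m)) := by
    intro m x hx0
    refine Summable.of_norm_bounded
      ((summable_v p x (c * p ^ m) hp0 hp1 hx0 (by positivity)).mul_right B) fun k => ?_
    have := hpos k
    rw [norm_mul, Real.norm_of_nonneg (by positivity)]
    exact mul_le_mul_of_nonneg_left (hA _) (by positivity)
  have hq : ∀ k : ℕ, 0 < 1 - p ^ (k+1) := fun k => by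
    have := pow_lt_one₀ hp0.le hp1 (Nat.succ_ne_zero k)
    simp only [Nat.succ_eq_add_one] at this
    linarith
  have F1 : ∀ m x, 0 < x → x < 1 → F m x - F m (p * x) = x * F (m+1) x := by
    intro m x hx0 hx1
    have hx2 : p * x < 1 := by nlinarith
    have hx3 : 0 < p * x := by positivity
    simp only [hF]
    rw [← (sF m x hx0 hx1).tsum_sub (sF m _ hx3 hx2), ((sF m x hx0 hx1).sub (sF m _ hx3 hx2)).tsum_eq_zero_add,
      ← tsum_mul_left]
    simp only [pow_zero, sub_self, zero_add]
    refine tsum_congr fun k => ?_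
    have h1 := (hpos k).ne'
    have h2 := (hq k).ne'
    rw [qPoch_succ, show k + 1 + m = k + (m + 1) by ring, mul_pow]
    field_simp
    ring
  have F2 : ∀ m x, 0 < x → x < 1 → F m x = F (m+1) x - c * p ^ (m+1) * F (m+1) (p * x) := by
    intro m x hx0 hx1
    have hx2 : p * x < 1 := by nlinarith
    have hx3 : 0 < p * x := by positivity
    simp only [hF]
    rw [← tsum_mul_left, ← (sF (m+1) x hx0 hx1).tsum_sub ((sF (m+1) _ hx3 hx2).mul_left _)]
    refine tsum_congr fun k => ?_
    rw [hrec (k + m), show k + (m + 1) = k + m + 1 by ring, mul_pow]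
    ring
  have F3 : ∀ m x, 0 < x → x < 1 →
      (1 - x) * F m x = F m (p * x) + x * c * p ^ (m+1) * F (m+1) (p * x) := by
    intro m x hx0 hx1
    linear_combination F1 m x hx0 hx1 - x * F2 m x hx0 hx1
  have G3 : ∀ m x, 0 < x →
      G m x = G m (p * x) + x * c * p ^ (m+1) * G (m+1) (p * x) := by
    intro m x hx0
    have hx3 : 0 < p * x := by positivity
    rw [← sub_eq_iff_eq_add']
    simp only [hG]
    rw [← (sG m x hx0).tsum_sub (sG m _ hx3), ((sG m x hx0).sub (sG m _ hx3)).tsum_eq_zero_add,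
      ← tsum_mul_left]
    simp only [pow_zero, sub_self, zero_add]
    refine tsum_congr fun k => ?_
    have h1 := (hpos k).ne'
    have h2 := (hq k).ne'
    have h5 : p ^ ((k+1)^2) = p ^ (k^2) * (p ^ k * p ^ (k+1)) := by ring
    rw [qPoch_succ, show k + 1 + m = k + (m + 1) by ring, h5]
    field_simp
    ring
  set D : ℕ → ℕ → ℝ := fun m N =>
    qPochInf (w * p ^ N) p * F m (w * p ^ N) - G m (w * p ^ N) with hD
  have hwN : ∀ N : ℕ, w * p ^ N ≤ w := fun N =>
    mul_le_of_le_one_right hw0.le (pow_le_one₀ hp0.le hp1.le)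
  have D3 : ∀ m N, D m N = D m (N+1) + w * p ^ N * c * p ^ (m+1) * D (m+1) (N+1) := by
    intro m N
    have hx0 : 0 < w * p ^ N := by positivity
    have hx1 : w * p ^ N < 1 := (hwN N).trans_lt hw1
    have e : w * p ^ (N+1) = p * (w * p ^ N) := by ring
    simp only [hD, e]
    rw [qPochInf_step _ p hp0 hp1, G3 m _ hx0]
    linear_combination qPochInf (p * (w * p ^ N)) p * F3 m _ hx0 hx1
  have D4 : ∀ N ε, 0 ≤ ε → (∀ m, |D m N| ≤ ε) →
      ∀ m, |D m 0| ≤ ε * Real.exp (∑ j ∈ Finset.range N, c * p ^ j) := by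
    intro N
    induction N with
    | zero => intro ε _ h m; simpa using h m
    | succ N ih =>
      intro ε hε h m
      rw [Finset.sum_range_succ, add_comm, Real.exp_add, ← mul_assoc]
      refine ih _ (by positivity) (fun m => ?_) m
      rw [D3]
      have h1 : w * p ^ N * c * p ^ (m+1) ≤ c * p ^ N := by
        have : p ^ (m+1) ≤ 1 := pow_le_one₀ hp0.le hp1.le
        calc w * p ^ N * c * p ^ (m+1) ≤ 1 * p ^ N * c * 1 := by gcongr
          _ = _ := by ring
      have h0 : 0 ≤ w * p ^ N * c * p ^ (m+1) := by positivity
      calc _ ≤ |D m (N+1)| + |w * p ^ N * c * p ^ (m+1) * D (m+1) (N+1)| := abs_add_le _ _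
        _ = |D m (N+1)| + w * p ^ N * c * p ^ (m+1) * |D (m+1) (N+1)| := by
          rw [abs_mul, abs_of_nonneg h0]
        _ ≤ ε + c * p ^ N * ε := by
          gcongr
          · exact h m
          · exact h _
        _ = ε * (c * p ^ N + 1) := by ring
        _ ≤ _ := by gcongr; exact Real.add_one_le_exp _
  set U := ∑' k : ℕ, w ^ k / qPoch p p k with hU
  set V := ∑' k : ℕ, c ^ k * p ^ (k ^ 2) * w ^ k / qPoch p p k with hV
  have q0 : qPoch p p 0 = 1 := by simp [qPoch]
  have FA : ∀ m N, |F m (w * p ^ N) - A m| ≤ p ^ N * (B * U) := by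
    intro m N
    have := series_close (fun k => w ^ k / qPoch p p k * A (k + m)) (fun k => w ^ k / qPoch p p k)
      B p hp0 hp1 hB (fun k => by have := hpos k; positivity) (summable_u p w hp0 hp1 hw0 hw1)
      (fun k => by
        have := hpos k
        rw [abs_mul, abs_of_nonneg (a := w ^ k / qPoch p p k) (by positivity)]
        exact mul_le_mul_of_nonneg_left (hA _) (by positivity)) N
    simp only [pow_zero, q0, zero_add, div_one, one_mul] at this
    convert this using 4
    funext k
    rw [mul_pow]; ring
  have GA : ∀ m N, |G m (w * p ^ N) - A m| ≤ p ^ N * (B * V) := by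
    intro m N
    have := series_close (fun k => (c * p ^ m) ^ k * p ^ (k ^ 2) * w ^ k / qPoch p p k * A (k + m))
      (fun k => c ^ k * p ^ (k ^ 2) * w ^ k / qPoch p p k)
      B p hp0 hp1 hB (fun k => by have := hpos k; positivity) (summable_v p w c hp0 hp1 hw0 hc)
      (fun k => by
        have := hpos k
        rw [abs_mul, abs_of_nonneg (a := (c * p ^ m) ^ k * p ^ (k ^ 2) * w ^ k / qPoch p p k) (by positivity)]
        refine mul_le_mul ?_ (hA _) (abs_nonneg _) (by positivity)
        have : c * p ^ m ≤ c := mul_le_of_le_one_right hc.le (pow_le_one₀ hp0.le hp1.le)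
        gcongr) N
    simp only [pow_zero, q0, zero_add, div_one, one_mul, mul_one, ne_eq, OfNat.ofNat_ne_zero,
      not_false_eq_true, zero_pow] at this
    convert this using 4
    funext k
    rw [mul_pow w]; ring
  have hU0 : 0 ≤ U := tsum_nonneg fun k => by have := hpos k; positivity
  have DA : ∀ m N, |D m N| ≤ (Real.exp (w * p ^ N / (1 - p)) - 1) * (B * U + B)
      + p ^ N * (B * U) + p ^ N * (B * V) := by
    intro m N
    have e : D m N = (qPochInf (w * p ^ N) p - 1) * F m (w * p ^ N)
      + (F m (w * p ^ N) - A m) - (G m (w * p ^ N) - A m) := by simp only [hD]; ring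
    have h1 := qPochInf_bound (w * p ^ N) p (by positivity) hp0 hp1
    have h2 : |F m (w * p ^ N)| ≤ B * U + B := by
      have h3 := abs_add_le (F m (w * p ^ N) - A m) (A m)
      rw [sub_add_cancel] at h3
      have h4 : p ^ N * (B * U) ≤ B * U :=
        mul_le_of_le_one_left (by positivity) (pow_le_one₀ hp0.le hp1.le)
      linarith [FA m N, hA m]
    rw [e]
    refine (abs_sub _ _).trans (add_le_add ((abs_add_le _ _).trans (add_le_add ?_ (FA m N))) (GA m N))
    rw [abs_mul]
    exact mul_le_mul h1 h2 (abs_nonneg _) ((abs_nonneg _).trans h1)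
  have hgeo : ∀ N, ∑ j ∈ Finset.range N, c * p ^ j ≤ c * (1 - p)⁻¹ := fun N =>
    sum_le_hasSum _ (fun i _ => by positivity) ((hasSum_geometric_of_lt_one hp0.le hp1).mul_left c)
  have ht0 := (tendsto_pow_atTop_nhds_zero_of_lt_one hp0.le hp1)
  have lim : Tendsto (fun N : ℕ => ((Real.exp (w * p ^ N / (1 - p)) - 1) * (B * U + B)
      + p ^ N * (B * U) + p ^ N * (B * V)) * Real.exp (c * (1 - p)⁻¹)) atTop
      (nhds (((Real.exp (w * 0 / (1 - p)) - 1) * (B * U + B)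
      + 0 * (B * U) + 0 * (B * V)) * Real.exp (c * (1 - p)⁻¹))) := by
    refine Tendsto.mul_const _ (((Tendsto.mul_const _ (Tendsto.sub_const ?_ _)).add
      (ht0.mul_const _)).add (ht0.mul_const _))
    exact (Real.continuous_exp.tendsto _).comp ((ht0.const_mul w).div_const _)
  simp only [mul_zero, zero_div, Real.exp_zero, sub_self, zero_mul, add_zero] at lim
  have hD0 : |D 0 0| ≤ 0 := by
    refine ge_of_tendsto' lim fun N => ?_
    have h0 := (abs_nonneg _).trans (DA 0 N)
    refine (D4 N _ h0 (fun m => DA m N) 0).trans ?_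
    gcongr
    exact hgeo N
  have := abs_nonpos_iff.1 hD0
  simp only [hD, hF, hG, pow_zero, mul_one, add_zero] at this
  linarith

lemma qPochInf_pos_ne (p w : ℝ) (hp0 : 0 < p) (hp1 : p < 1) (hw0 : 0 < w) (hw1 : w < 1) :
    qPochInf w p ≠ 0 := by
  intro h
  have hz : ∀ N : ℕ, qPochInf (w * p ^ N) p = 0 := by
    intro N
    induction N with
    | zero => simpa using h
    | succ N ih =>
      rw [qPochInf_step _ p hp0 hp1] at ih
      have : w * p ^ N ≤ w := mul_le_of_le_one_right hw0.le (pow_le_one₀ hp0.le hp1.le)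
      rcases mul_eq_zero.1 ih with h | h
      · linarith
      · rw [← h]; ring_nf
  have ht0 := (tendsto_pow_atTop_nhds_zero_of_lt_one hp0.le hp1)
  have lim : Tendsto (fun N : ℕ => Real.exp (w * p ^ N / (1 - p)) - 1) atTop
      (nhds (Real.exp (w * 0 / (1 - p)) - 1)) :=
    Tendsto.sub_const ((Real.continuous_exp.tendsto _).comp ((ht0.const_mul w).div_const _)) _
  simp only [mul_zero, zero_div, Real.exp_zero, sub_self] at lim
  have : (1:ℝ) ≤ 0 := ge_of_tendsto' lim fun N => by
    have := qPochInf_bound (w * p ^ N) p (by positivity) hp0 hp1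
    rw [hz N] at this
    simpa using this
  linarith

/-- `I_ν^{(1)} = e_{q²}((1-q²)²z²/4) I_ν^{(2)}`, equivalently
`I_ν^{(2)} = ((1-q²)²z²/4; q²)_∞ I_ν^{(1)}`. -/
theorem stmt6 (q ν : ℝ) (hq0 : 0 < q) (hq1 : q < 1)
    (z : ℝ) (hz0 : 0 < z) (hz : z < 2 / (1 - q ^ 2)) :
    Iq q 1 ν z = (qPochInf ((1 - q ^ 2) ^ 2 * z ^ 2 / 4) (q ^ 2))⁻¹ * Iq q 2 ν z
  ∧ Iq q 2 ν z = qPochInf ((1 - q ^ 2) ^ 2 * z ^ 2 / 4) (q ^ 2) * Iq q 1 ν z := by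
  have hp0 : 0 < q ^ 2 := by positivity
  have hp1 : q ^ 2 < 1 := pow_lt_one₀ hq0.le hq1 (by norm_num)
  have h1p : 0 < 1 - q ^ 2 := by linarith
  set w := (1 - q ^ 2) ^ 2 * z ^ 2 / 4 with hw
  have hw0 : 0 < w := by positivity
  have hw1 : w < 1 := by
    rw [lt_div_iff₀ h1p] at hz
    have : 0 < z * (1 - q ^ 2) := by positivity
    rw [hw]; nlinarith
  have hc : 0 < q ^ (2 * ν) := Real.rpow_pos_of_pos hq0 _
  set A : ℕ → ℝ := fun k => qPochInf (q ^ (2 * ν) * (q ^ 2) ^ (k + 1)) (q ^ 2) with hAdef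
  set C : ℝ := (z / 2) ^ ν * (1 - q ^ 2) ^ ν / qPochInf (q ^ 2) (q ^ 2) with hC
  have hcore := core (q ^ 2) (q ^ (2 * ν)) w A (Real.exp (q ^ (2 * ν) / (1 - q ^ 2))) hp0 hp1 hw0 hw1 hc
    (Real.exp_pos _).le
    (fun k => by
      have h1 := qPochInf_bound (q ^ (2 * ν) * (q ^ 2) ^ (k + 1)) (q ^ 2) (by positivity) hp0 hp1
      have h2 := abs_add_le (A k - 1) 1
      rw [sub_add_cancel, abs_one] at h2
      have h3 : Real.exp (q ^ (2 * ν) * (q ^ 2) ^ (k + 1) / (1 - q ^ 2))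
          ≤ Real.exp (q ^ (2 * ν) / (1 - q ^ 2)) := by
        gcongr
        exact mul_le_of_le_one_right hc.le (pow_le_one₀ hp0.le hp1.le)
      simp only [hAdef] at h2 ⊢
      linarith)
    (fun k => by
      simp only [hAdef]
      rw [qPochInf_step _ _ hp0 hp1]
      congr 2
      ring)
  have hg : ∀ k : ℕ, (1 - q ^ 2) ^ k * (z / 2) ^ (ν + 2 * k) * qGammaInv q (ν + k + 1)
      = C * (w ^ k * A k) := by
    intro k
    have e1 : q ^ (2 * (ν + k + 1)) = q ^ (2 * ν) * (q ^ 2) ^ (k + 1) := by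
      rw [← pow_mul, ← Real.rpow_natCast q (2 * (k + 1)), ← Real.rpow_add hq0]
      congr 1; push_cast; ring
    have e2 : (z / 2) ^ (ν + 2 * k) = (z / 2) ^ ν * ((z / 2) ^ 2) ^ k := by
      rw [← pow_mul, ← Real.rpow_natCast _ (2 * k), ← Real.rpow_add (by positivity)]
      congr 1; push_cast; ring
    have e3 : (1 - q ^ 2) ^ (ν + k + 1 - 1) = (1 - q ^ 2) ^ ν * (1 - q ^ 2) ^ k := by
      rw [← Real.rpow_natCast _ k, ← Real.rpow_add h1p]
      congr 1; ring
    have e4 : w ^ k = (1 - q ^ 2) ^ k * (1 - q ^ 2) ^ k * ((z / 2) ^ 2) ^ k := by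
      rw [← mul_pow, ← mul_pow, hw]; congr 1; ring
    unfold qGammaInv
    rw [e1, e2, e3, e4, hC]
    simp only [hAdef]
    ring
  have I1 : Iq q 1 ν z = C * ∑' k : ℕ, w ^ k / qPoch (q ^ 2) (q ^ 2) k * A k := by
    unfold Iq
    rw [← tsum_mul_left]
    refine tsum_congr fun k => ?_
    have : (2 - delta 1) * k * (ν + k) = 0 := by simp [delta]
    rw [this, Real.rpow_zero]
    linear_combination (qPoch (q ^ 2) (q ^ 2) k)⁻¹ * hg k
  have I2 : Iq q 2 ν z = C * ∑' k : ℕ,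
      (q ^ (2 * ν)) ^ k * (q ^ 2) ^ (k ^ 2) * w ^ k / qPoch (q ^ 2) (q ^ 2) k * A k := by
    unfold Iq
    rw [← tsum_mul_left]
    refine tsum_congr fun k => ?_
    have : q ^ ((2 - delta 2) * k * (ν + k)) = (q ^ (2 * ν)) ^ k * (q ^ 2) ^ (k ^ 2) := by
      rw [← pow_mul, ← Real.rpow_natCast _ k, ← Real.rpow_mul hq0.le,
        ← Real.rpow_natCast q (2 * k ^ 2), ← Real.rpow_add hq0]
      congr 1; simp only [delta]; push_cast; ring
    rw [this]
    linear_combination (q ^ (2 * ν)) ^ k * (q ^ 2) ^ (k ^ 2) * (qPoch (q ^ 2) (q ^ 2) k)⁻¹ * hg k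
  have hne := qPochInf_pos_ne (q ^ 2) w hp0 hp1 hw0 hw1
  have key : Iq q 2 ν z = qPochInf w (q ^ 2) * Iq q 1 ν z := by
    rw [I1, I2, hcore]; ring
  refine ⟨?_, key⟩
  rw [key, inv_mul_cancel_left₀ hne]

end
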